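/- arXiv:2206.11369 — 2 statements merged into one kernel-verified Lean document; each statement's English description precedes it below -/
import Mathlib

section
/- Let β > 0 and let r ∈ ℝ^{𝒳̂} be a probability distribution with r(x̂) > 0 for every x̂ ∈ 𝒳̂, and let q := q[r] be the associated encoder. Then the Jacobian of the map r ↦ r − BA_β[r] at r is given entrywise by ∂(r(x̂_i) − BA_β[r](x̂_i)) / ∂r(x̂_j) = ∑_x p_X(x)·q(x̂_j|x)·q(x̂_i|x) / r(x̂_j) + δ_{i,j}·(r(x̂_j) − BA_β[r](x̂_j)) / r(x̂_j), where δ is the Kronecker delta. -/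
open scoped BigOperators

variable {X Xhat : Type*} [Fintype X] [Fintype Xhat] [DecidableEq Xhat]

/-- The partition function `Z(x, β) = ∑_{x̂'} r(x̂')·e^{−β d(x,x̂')}`. -/
noncomputable def Zf (d : X → Xhat → ℝ) (r : Xhat → ℝ) (β : ℝ) (x : X) : ℝ :=
  ∑ xh' : Xhat, r xh' * Real.exp (-β * d x xh')

/-- The encoder `q[r](x̂|x) = r(x̂)·e^{−β d(x,x̂)} / Z(x,β)`. -/
noncomputable def enc (d : X → Xhat → ℝ) (r : Xhat → ℝ) (β : ℝ) (xh : Xhat) (x : X) : ℝ :=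
  r xh * Real.exp (-β * d x xh) / Zf d r β x

/-- The Blahut–Arimoto iteration `BA_β[r](x̂) = ∑_x p_X(x)·q[r](x̂|x)`. -/
noncomputable def BA (p : X → ℝ) (d : X → Xhat → ℝ) (β : ℝ) (r : Xhat → ℝ) (xh : Xhat) : ℝ :=
  ∑ x : X, p x * enc d r β xh x

/-- Partial derivative of a function of `r ∈ ℝ^{𝒳̂}` with respect to the coordinate `r(j)`. -/
noncomputable def pd (j : Xhat) (f : (Xhat → ℝ) → ℝ) : (Xhat → ℝ) → ℝ :=
  fun r => fderiv ℝ f r (Pi.single j 1)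

lemma hasFDerivAt_Zf (d : X → Xhat → ℝ) (β : ℝ) (x : X) (r : Xhat → ℝ) :
    HasFDerivAt (fun r' => Zf d r' β x)
      (∑ k, Real.exp (-β * d x k) • ContinuousLinearMap.proj (R := ℝ) (φ := fun _ : Xhat => ℝ) k)
      r := by
  unfold Zf
  exact HasFDerivAt.fun_sum fun k _ => (hasFDerivAt_apply k r).mul_const _

lemma hasFDerivAt_enc (d : X → Xhat → ℝ) (β : ℝ) (i : Xhat) (x : X) {r : Xhat → ℝ}
    (hZ : Zf d r β x ≠ 0) :
    ∃ L : (Xhat → ℝ) →L[ℝ] ℝ, HasFDerivAt (fun r' => enc d r' β i x) L r ∧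
      ∀ j, r j ≠ 0 → L (Pi.single j 1) =
        ((if i = j then enc d r β j x else 0) - enc d r β j x * enc d r β i x) / r j := by
  have hinv := (hasDerivAt_inv hZ).comp_hasFDerivAt r (hasFDerivAt_Zf d β x r)
  refine ⟨_, ((hasFDerivAt_apply (𝕜 := ℝ) i r).mul_const (Real.exp (-β * d x i))).mul hinv,
    fun j hj => ?_⟩
  by_cases hij : i = j
  · subst hij
    simp [enc, Pi.single_apply]
    field_simp
    ring
  · simp [enc, Pi.single_apply, hij]
    field_simp

lemma Zf_pos (d : X → Xhat → ℝ) (β : ℝ) (x : X) [Nonempty Xhat] {r : Xhat → ℝ}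
    (hr : ∀ k, 0 < r k) : 0 < Zf d r β x :=
  Finset.sum_pos (fun k _ => mul_pos (hr k) (Real.exp_pos _)) Finset.univ_nonempty

/-- **The Jacobian of `Id − BA_β` in cluster-marginal coordinates** (Corollary
`cor:BA-jacobian`): at a fully supported probability distribution `r`,
`∂(r(x̂ᵢ) − BA_β[r](x̂ᵢ))/∂r(x̂ⱼ) = ∑_x p(x)·q(x̂ⱼ|x)·q(x̂ᵢ|x)/r(x̂ⱼ)
  + δ_{i,j}·(r(x̂ⱼ) − BA_β[r](x̂ⱼ))/r(x̂ⱼ)`. -/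
theorem jacobianIdSubBA (p : X → ℝ) (hp0 : ∀ x, 0 ≤ p x) (hp1 : ∑ x, p x = 1)
    (d : X → Xhat → ℝ) (β : ℝ) (hβ : 0 < β)
    (r : Xhat → ℝ) (hr0 : ∀ xh, 0 < r xh) (hr1 : ∑ xh, r xh = 1)
    (xi xj : Xhat) :
    pd xj (fun r' => r' xi - BA p d β r' xi) r =
      (∑ x, p x * enc d r β xj x * enc d r β xi x / r xj) +
        (if xi = xj then (1 : ℝ) else 0) * (r xj - BA p d β r xj) / r xj := by
  have : Nonempty Xhat := ⟨xi⟩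
  choose L hL hLj using fun x => hasFDerivAt_enc d β xi x (Zf_pos d β x hr0).ne'
  have hBA : HasFDerivAt (fun r' => r' xi - BA p d β r' xi)
      (ContinuousLinearMap.proj (R := ℝ) (φ := fun _ : Xhat => ℝ) xi - ∑ x, p x • L x) r := by
    unfold BA
    exact (hasFDerivAt_apply xi r).fun_sub
      (HasFDerivAt.fun_sum fun x _ => (hL x).const_mul (p x))
  have hj : r xj ≠ 0 := (hr0 xj).ne'
  rw [pd, hBA.fderiv]
  simp only [sub_apply, sum_apply,
    smul_apply, ContinuousLinearMap.proj_apply, smul_eq_mul,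
    hLj _ xj hj, BA, Pi.single_apply]
  split_ifs with h
  · rw [one_mul, sub_div, div_self hj, Finset.sum_div, add_sub_left_comm, ← Finset.sum_sub_distrib,
      sub_eq_add_neg, ← Finset.sum_neg_distrib]
    congr 1
    exact Finset.sum_congr rfl fun x _ => by ring
  · rw [zero_mul, zero_div, add_zero, zero_sub, ← Finset.sum_neg_distrib]
    exact Finset.sum_congr rfl fun x _ => by ring
end

section
/- Let r be a probability distribution on 𝒳̂, and for β > 0 let q_β := q[r] be the associated encoder. Then for every β > 0 and every x̂ ∈ 𝒳̂: ∂/∂β [ r(x̂) − BA_β[r](x̂) ] = ∑_x p_X(x)·q_β(x̂|x)·d(x,x̂) − ∑_x ∑_{x̂'} p_X(x)·q_β(x̂'|x)·q_β(x̂|x)·d(x,x̂'), where the derivative is taken in β with r held fixed. -/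
open scoped BigOperators

variable {X Xhat : Type*} [Fintype X] [Fintype Xhat]

theorem Zf_pos_s6 {α κ : Type*} [Fintype κ] (d : α → κ → ℝ) {r : κ → ℝ} (hr0 : ∀ xh, 0 ≤ r xh)
    (hr1 : ∑ xh, r xh = 1) (β : ℝ) (x : α) : 0 < Zf d r β x := by
  obtain ⟨i, hi, hne⟩ : ∃ i ∈ Finset.univ, r i ≠ 0 :=
    Finset.exists_ne_zero_of_sum_ne_zero (by rw [hr1]; exact one_ne_zero)
  exact Finset.sum_pos' (fun j _ => mul_nonneg (hr0 j) (Real.exp_pos _).le)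
    ⟨i, hi, mul_pos ((hr0 i).lt_of_ne' hne) (Real.exp_pos _)⟩

theorem hasDerivAt_mul_exp_neg_mul {α κ : Type*} (d : α → κ → ℝ) (r : κ → ℝ) (β : ℝ) (xh : κ)
    (x : α) :
    HasDerivAt (fun β' => r xh * Real.exp (-β' * d x xh))
      (-(r xh * Real.exp (-β * d x xh) * d x xh)) β := by
  exact (((hasDerivAt_id' β).fun_neg.mul_const (d x xh)).exp.const_mul (r xh)).congr_deriv
    (by ring)

theorem hasDerivAt_Zf {α κ : Type*} [Fintype κ] (d : α → κ → ℝ) (r : κ → ℝ) (β : ℝ) (x : α) :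
    HasDerivAt (fun β' => Zf d r β' x)
      (-∑ xh, r xh * Real.exp (-β * d x xh) * d x xh) β := by
  rw [← Finset.sum_neg_distrib]
  exact HasDerivAt.fun_sum fun xh _ => hasDerivAt_mul_exp_neg_mul d r β xh x

theorem hasDerivAt_enc {α κ : Type*} [Fintype κ] (d : α → κ → ℝ) (r : κ → ℝ) (β : ℝ) (xh : κ) (x : α)
    (hZ : Zf d r β x ≠ 0) :
    HasDerivAt (fun β' => enc d r β' xh x)
      (-(enc d r β xh x * d x xh) + enc d r β xh x * ∑ xh', enc d r β xh' x * d x xh') β := by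
  refine ((hasDerivAt_mul_exp_neg_mul d r β xh x).fun_div (hasDerivAt_Zf d r β x)
    hZ).congr_deriv ?_
  have hsum : ∑ xh', enc d r β xh' x * d x xh' =
      (∑ xh', r xh' * Real.exp (-β * d x xh') * d x xh') / Zf d r β x := by
    rw [Finset.sum_div]
    exact Finset.sum_congr rfl fun _ _ => div_mul_eq_mul_div _ _ _
  rw [hsum, enc]
  field_simp
  ring

/-- **The partial `β`-derivative of `Id − BA_β`** (Corollary `cor:BA-beta-deriv`):
`∂/∂β [r(x̂) − BA_β[r](x̂)] = ∑_x p(x)·q_β(x̂|x)·d(x,x̂)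
  − ∑_x ∑_{x̂'} p(x)·q_β(x̂'|x)·q_β(x̂|x)·d(x,x̂')`, with `r` held fixed. -/
theorem betaDerivIdSubBA (p : X → ℝ) (hp0 : ∀ x, 0 ≤ p x) (hp1 : ∑ x, p x = 1)
    (d : X → Xhat → ℝ) (r : Xhat → ℝ)
    (hr0 : ∀ xh, 0 ≤ r xh) (hr1 : ∑ xh, r xh = 1)
    (β : ℝ) (hβ : 0 < β) (xh : Xhat) :
    deriv (fun β' => r xh - BA p d β' r xh) β =
      (∑ x, p x * enc d r β xh x * d x xh) -
        ∑ x, ∑ xh', p x * enc d r β xh' x * enc d r β xh x * d x xh' := by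
  have hBA : HasDerivAt (fun β' => BA p d β' r xh) _ β :=
    HasDerivAt.fun_sum fun x _ =>
      (hasDerivAt_enc d r β xh x (Zf_pos_s6 d hr0 hr1 β x).ne').const_mul (p x)
  rw [(hBA.const_sub (r xh)).deriv, ← Finset.sum_sub_distrib, ← Finset.sum_neg_distrib]
  refine Finset.sum_congr rfl fun x _ => ?_
  have hsum : ∑ xh', p x * enc d r β xh' x * enc d r β xh x * d x xh' =
      p x * enc d r β xh x * ∑ xh', enc d r β xh' x * d x xh' := by
    rw [Finset.mul_sum]
    exact Finset.sum_congr rfl fun _ _ => by ring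
  rw [hsum]
  ring
end
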